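/- Subtracts always embed: for every open embedding e : G → M, the subtraction M −_e G admits an open embedding into M. -/

import Mathlib

open CategoryTheory

/-- A pre-open graph: a set of edges, vertices and edge-points, with source and
target maps into the disjoint union of vertices and edge-points. -/
structure POG : Type 1 where
  E : Type
  V : Type
  Eps : Type
  s : E → V ⊕ Eps
  t : E → V ⊕ Eps

namespace POG

/-- A pre-open graph is an open graph when every edge-point is the source of at
most one edge and the target of at most one edge. -/
def IsOpen (G : POG) : Prop :=
  (∀ e e' p, G.s e = Sum.inr p → G.s e' = Sum.inr p → e = e') ∧
  (∀ e e' p, G.t e = Sum.inr p → G.t e' = Sum.inr p → e = e')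

def IsFinite (G : POG) : Prop := Finite G.E ∧ Finite G.V ∧ Finite G.Eps

/-- The edge-point `p` has an in-edge. -/
def HasIn (G : POG) (p : G.Eps) : Prop := ∃ e, G.t e = Sum.inr p

/-- The edge-point `p` has an out-edge. -/
def HasOut (G : POG) (p : G.Eps) : Prop := ∃ e, G.s e = Sum.inr p

/-- An input: an edge-point with an out-edge and no in-edge. -/
def IsInput (G : POG) (p : G.Eps) : Prop := G.HasOut p ∧ ¬ G.HasIn p

/-- An output: an edge-point with an in-edge and no out-edge. -/
def IsOutput (G : POG) (p : G.Eps) : Prop := G.HasIn p ∧ ¬ G.HasOut p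

/-- A boundary point is an input or an output. -/
def IsBoundaryPt (G : POG) (p : G.Eps) : Prop := G.IsInput p ∨ G.IsOutput p

/-- An isolated point: no in-edges and no out-edges. -/
def IsIsolated (G : POG) (p : G.Eps) : Prop := ¬ G.HasIn p ∧ ¬ G.HasOut p

/-- A point graph consists solely of (isolated) edge-points: no edges, no vertices. -/
def IsPointGraph (G : POG) : Prop := IsEmpty G.E ∧ IsEmpty G.V

def Inputs (G : POG) : Type := {p : G.Eps // G.IsInput p}

def Outputs (G : POG) : Type := {p : G.Eps // G.IsOutput p}

/-- Two graphs have the same boundary when their interfaces are isomorphic,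
i.e. there are bijections between their inputs and between their outputs. -/
def SameBoundary (G H : POG) : Prop :=
  Nonempty (G.Inputs ≃ H.Inputs) ∧ Nonempty (G.Outputs ≃ H.Outputs)

/-- The tensor product (disjoint union) of two graphs: the merging along the
empty graph. -/
def tensor (G H : POG) : POG where
  E := G.E ⊕ H.E
  V := G.V ⊕ H.V
  Eps := G.Eps ⊕ H.Eps
  s := fun e => match e with
    | Sum.inl e => Sum.map Sum.inl Sum.inl (G.s e)
    | Sum.inr e => Sum.map Sum.inr Sum.inr (H.s e)
  t := fun e => match e with
    | Sum.inl e => Sum.map Sum.inl Sum.inl (G.t e)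
    | Sum.inr e => Sum.map Sum.inr Sum.inr (H.t e)

/-- The one-step contraction of an open graph `G` at an interior edge-point `p`
with (unique) in-edge `e₁` and (unique) out-edge `e₂`: the edges `e₁, e₂` and
the point `p` are replaced by a single fresh edge from the source of `e₁` to
the target of `e₂`. -/
def contract (G : POG) (hG : G.IsOpen) (p : G.Eps) (e₁ e₂ : G.E)
    (h1 : G.t e₁ = Sum.inr p) (h2 : G.s e₂ = Sum.inr p) (hne : e₁ ≠ e₂) : POG where
  E := {e : G.E // e ≠ e₁ ∧ e ≠ e₂} ⊕ PUnit
  V := G.V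
  Eps := {q : G.Eps // q ≠ p}
  s := fun x => match x with
    | Sum.inl ⟨e, he⟩ =>
        match h : G.s e with
        | Sum.inl v => Sum.inl v
        | Sum.inr q => Sum.inr ⟨q, fun hq => he.2 (hG.1 e e₂ p (hq ▸ h) h2)⟩
    | Sum.inr _ =>
        match h : G.s e₁ with
        | Sum.inl v => Sum.inl v
        | Sum.inr q => Sum.inr ⟨q, fun hq => hne (hG.1 e₁ e₂ p (hq ▸ h) h2)⟩
  t := fun x => match x with
    | Sum.inl ⟨e, he⟩ =>
        match h : G.t e with
        | Sum.inl v => Sum.inl v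
        | Sum.inr q => Sum.inr ⟨q, fun hq => he.1 (hG.2 e e₁ p (hq ▸ h) h1)⟩
    | Sum.inr _ =>
        match h : G.t e₂ with
        | Sum.inl v => Sum.inl v
        | Sum.inr q => Sum.inr ⟨q, fun hq => hne ((hG.2 e₂ e₁ p (hq ▸ h) h1).symm)⟩

end POG

/-- A homomorphism of pre-open graphs: maps on edges, vertices and edge-points
commuting with source and target. -/
structure POGHom (G H : POG) : Type where
  edgeMap : G.E → H.E
  vMap : G.V → H.V
  epMap : G.Eps → H.Eps
  s_comm : ∀ e, H.s (edgeMap e) = Sum.map vMap epMap (G.s e)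
  t_comm : ∀ e, H.t (edgeMap e) = Sum.map vMap epMap (G.t e)

namespace POGHom

def id (G : POG) : POGHom G G where
  edgeMap := fun e => e
  vMap := fun v => v
  epMap := fun q => q
  s_comm := fun e => by cases h : G.s e <;> simp [h]
  t_comm := fun e => by cases h : G.t e <;> simp [h]

def comp {G H K : POG} (g : POGHom H K) (f : POGHom G H) : POGHom G K where
  edgeMap := fun e => g.edgeMap (f.edgeMap e)
  vMap := fun v => g.vMap (f.vMap v)
  epMap := fun q => g.epMap (f.epMap q)
  s_comm := fun e => by rw [g.s_comm, f.s_comm]; cases G.s e <;> rfl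
  t_comm := fun e => by rw [g.t_comm, f.t_comm]; cases G.t e <;> rfl

/-- The homomorphism is injective (a monomorphism). -/
def Inj {G H : POG} (f : POGHom G H) : Prop :=
  Function.Injective f.edgeMap ∧ Function.Injective f.vMap ∧ Function.Injective f.epMap

/-- The homomorphism is full on vertices: every edge of the codomain incident to
the image of a vertex is itself in the image. -/
def FullOnVertices {G H : POG} (f : POGHom G H) : Prop :=
  ∀ (v : G.V) (e : H.E),
    (H.s e = Sum.inl (f.vMap v) ∨ H.t e = Sum.inl (f.vMap v)) → ∃ e₀, f.edgeMap e₀ = e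

/-- An open embedding: an injective homomorphism which is full on vertices. -/
def IsEmbedding {G H : POG} (f : POGHom G H) : Prop := f.Inj ∧ f.FullOnVertices

/-- An isomorphism of pre-open graphs. -/
def IsIso {G H : POG} (f : POGHom G H) : Prop :=
  Function.Bijective f.edgeMap ∧ Function.Bijective f.vMap ∧ Function.Bijective f.epMap

end POGHom

/-- `G` and `H` are isomorphic pre-open graphs. -/
def Isomorphic (G H : POG) : Prop := ∃ f : POGHom G H, f.IsIso

/-- A pair of homomorphisms with common domain is boundary-coherent. -/
def BoundaryCoherent {K G₁ G₂ : POG} (f : POGHom K G₁) (g : POGHom K G₂) : Prop :=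
  (∀ p : K.Eps, K.IsBoundaryPt p →
      ¬ G₁.IsBoundaryPt (f.epMap p) → G₂.IsBoundaryPt (g.epMap p)) ∧
  (∀ p : K.Eps, K.IsIsolated p →
      G₁.IsIsolated (f.epMap p) ∨ G₂.IsIsolated (g.epMap p) ∨
      ((G₁.IsInput (f.epMap p) ↔ G₂.IsOutput (g.epMap p)) ∧
       (G₁.IsOutput (f.epMap p) ↔ G₂.IsInput (g.epMap p))))

/-- `M` together with `i₁, i₂` is the pushout of `e₁, e₂` in the category of
open graphs. -/
def IsPushout {K G₁ G₂ M : POG} (e₁ : POGHom K G₁) (e₂ : POGHom K G₂)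
    (i₁ : POGHom G₁ M) (i₂ : POGHom G₂ M) : Prop :=
  M.IsOpen ∧ i₁.comp e₁ = i₂.comp e₂ ∧
  ∀ (N : POG), N.IsOpen → ∀ (j₁ : POGHom G₁ N) (j₂ : POGHom G₂ N),
    j₁.comp e₁ = j₂.comp e₂ → ∃! u : POGHom M N, u.comp i₁ = j₁ ∧ u.comp i₂ = j₂

/-- A merging: the pushout in OGraph of a boundary-coherent pair of open
embeddings. -/
def IsMergingAt {K G₁ G₂ M : POG} (e₁ : POGHom K G₁) (e₂ : POGHom K G₂)
    (i₁ : POGHom G₁ M) (i₂ : POGHom G₂ M) : Prop :=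
  K.IsOpen ∧ G₁.IsOpen ∧ G₂.IsOpen ∧
  e₁.IsEmbedding ∧ e₂.IsEmbedding ∧ BoundaryCoherent e₁ e₂ ∧ IsPushout e₁ e₂ i₁ i₂

/-- A plugging: a merging whose shared graph is a point graph embedded by
boundary embeddings. -/
def IsPluggingAt {K G₁ G₂ M : POG} (e₁ : POGHom K G₁) (e₂ : POGHom K G₂)
    (i₁ : POGHom G₁ M) (i₂ : POGHom G₂ M) : Prop :=
  IsMergingAt e₁ e₂ i₁ i₂ ∧ K.IsPointGraph ∧
  (∀ q : K.Eps, G₁.IsBoundaryPt (e₁.epMap q)) ∧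
  (∀ q : K.Eps, G₂.IsBoundaryPt (e₂.epMap q))

/-- One contraction step, up to isomorphism: `H` is (isomorphic to) the result
of contracting away an interior edge-point of `G`. -/
def StepContract (G H : POG) : Prop :=
  ∃ (hG : G.IsOpen) (p : G.Eps) (e₁ e₂ : G.E) (h1 : G.t e₁ = Sum.inr p)
    (h2 : G.s e₂ = Sum.inr p) (hne : e₁ ≠ e₂),
    Isomorphic (G.contract hG p e₁ e₂ h1 h2 hne) H

/-- `H ≼ G`: `G` contracts to `H` (in any number of steps, up to isomorphism). -/
def ContractsTo (G H : POG) : Prop :=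
  Isomorphic G H ∨ Relation.TransGen StepContract G H

/-- `G ∼ H`: homeomorphism, the symmetric closure of the contraction order. -/
def Homeo (G H : POG) : Prop := ContractsTo G H ∨ ContractsTo H G

/-- A proper (minimal) open graph: minimal with respect to `≼`. -/
def POG.IsProper (G : POG) : Prop :=
  G.IsOpen ∧ ∀ H : POG, ContractsTo G H → Isomorphic G H

/-- `L` matches `G`: there is some `G' ∼ G` and an open embedding of `L` into `G'`. -/
def Matches (L G : POG) : Prop :=
  ∃ G' : POG, Homeo G' G ∧ ∃ e : POGHom L G', e.IsEmbedding

/-- Transport of a homomorphism out of an edgeless graph along a contraction. -/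
def contractTransport {K G : POG} (hKE : IsEmpty K.E) (f : POGHom K G)
    (hG : G.IsOpen) (p : G.Eps) (e₁ e₂ : G.E) (h1 : G.t e₁ = Sum.inr p)
    (h2 : G.s e₂ = Sum.inr p) (hne : e₁ ≠ e₂) (hp : ∀ q, f.epMap q ≠ p) :
    POGHom K (G.contract hG p e₁ e₂ h1 h2 hne) where
  edgeMap := fun e => (hKE.false e).elim
  vMap := f.vMap
  epMap := fun q => ⟨f.epMap q, hp q⟩
  s_comm := fun e => (hKE.false e).elim
  t_comm := fun e => (hKE.false e).elim

/-- A graph equipped with a homomorphism from a fixed (point) graph `K`. -/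
def PointedGraph (K : POG) : Type 1 := Σ G : POG, POGHom K G

/-- One contraction step of a `K`-pointed graph, transporting the distinguished
map along the contraction. -/
def StepContractRel (K : POG) (hKE : IsEmpty K.E) (x y : PointedGraph K) : Prop :=
  ∃ (hG : x.1.IsOpen) (p : x.1.Eps) (e₁ e₂ : x.1.E) (h1 : x.1.t e₁ = Sum.inr p)
    (h2 : x.1.s e₂ = Sum.inr p) (hne : e₁ ≠ e₂) (hp : ∀ q, x.2.epMap q ≠ p),
    ∃ φ : POGHom (x.1.contract hG p e₁ e₂ h1 h2 hne) y.1,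
      φ.IsIso ∧ φ.comp (contractTransport hKE x.2 hG p e₁ e₂ h1 h2 hne hp) = y.2

/-- Isomorphism of `K`-pointed graphs. -/
def IsoRel (K : POG) (x y : PointedGraph K) : Prop :=
  ∃ φ : POGHom x.1 y.1, φ.IsIso ∧ φ.comp x.2 = y.2

/-- Contraction order on `K`-pointed graphs, up to isomorphism. -/
def ContractsToRel (K : POG) (hKE : IsEmpty K.E) (x y : PointedGraph K) : Prop :=
  IsoRel K x y ∨ Relation.TransGen (StepContractRel K hKE) x y

/-- Homeomorphism of `K`-pointed graphs: `y.1 ∼ x.1`, with the distinguished map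
`x.2` "considered as a map into" `y.1` being `y.2`. -/
def HomeoRel (K : POG) (hKE : IsEmpty K.E) (x y : PointedGraph K) : Prop :=
  ContractsToRel K hKE x y ∨ ContractsToRel K hKE y x

/-- A rewrite rule: a pair of open graphs with the same boundary. -/
def IsRewrite (L R : POG) : Prop := L.IsOpen ∧ R.IsOpen ∧ POG.SameBoundary L R

/-- Two pluggings (of the same point graph `P` into the two sides `L`, `R` of
rewrite rules) correspond: along the identification of the boundaries,
corresponding plugged points have the same input/output status. -/
def PlugCorresponds {P L R : POG} (b : POGHom P L) (c : POGHom P R) : Prop :=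
  ∀ q : P.Eps, (L.IsInput (b.epMap q) ↔ R.IsInput (c.epMap q)) ∧
               (L.IsOutput (b.epMap q) ↔ R.IsOutput (c.epMap q))

/-- `M' = M[G ↦ G']ₑ`: substitution of `G'` for `G` in `M` at `e : G → M`,
defined by the pair of pushouts that first compute the subtraction `D = M −ₑ G`
(so that `M` is the plugging of `G` with `D` along the interface point graph
`P`) and then plug `G'` onto `D` along the same interface. -/
def IsSubstitutionAt (M : POG) {G : POG} (e : POGHom G M) (G' M' : POG) : Prop :=
  ∃ (D P : POG) (b : POGHom P G) (d : POGHom P D) (b' : POGHom P G')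
    (iD : POGHom D M) (iG' : POGHom G' M') (iD' : POGHom D M'),
    IsPluggingAt b d e iD ∧ IsPluggingAt b' d iG' iD'

/-- `G` rewrites to `H` by (an extension of) the rule `L → R`:
there are `G'' ∼ G` and a matching `e : L → G''` with `H = G''[L ↦ R]ₑ`. -/
def RewriteStep (L R G H : POG) : Prop :=
  ∃ G'' : POG, Homeo G'' G ∧
    ∃ e : POGHom L G'', e.IsEmbedding ∧ IsSubstitutionAt G'' e R H

/-- The category of open graphs. -/
abbrev OGraphCat : Type 1 := {G : POG // G.IsOpen}

instance : Category OGraphCat where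
  Hom X Y := POGHom X.val Y.val
  id X := POGHom.id X.val
  comp f g := g.comp f
  id_comp := fun _ => rfl
  comp_id := fun _ => rfl
  assoc := fun _ _ _ => rfl

/-- The vertices of the quiver underlying a graphical theory: the generating
set `S` of graphs. -/
abbrev RWQuiver (S : Set POG) (_R : Set (POG × POG)) : Type 1 := {G : POG // G ∈ S}

instance (S : Set POG) (R : Set (POG × POG)) : Quiver (RWQuiver S R) :=
  ⟨fun X Y => PLift ((X.val, Y.val) ∈ R)⟩

/-- The graphical theory on generators `S` and rewrite rules `R`: the category
whose objects are the graphs in `S` and whose arrows are formal sequential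
compositions (paths) of rewrites in `R`. -/
def GThy (S : Set POG) (R : Set (POG × POG)) : Type 1 := Paths (RWQuiver S R)

instance (S : Set POG) (R : Set (POG × POG)) : Category (GThy S R) :=
  inferInstanceAs (Category (Paths (RWQuiver S R)))

def toGThy {S : Set POG} {R : Set (POG × POG)} (X : RWQuiver S R) : GThy S R := X

/-- The tensor product on objects of a graphical theory. -/
def tensorMk {S : Set POG} {R : Set (POG × POG)}
    (hS : ∀ G ∈ S, ∀ H ∈ S, POG.tensor G H ∈ S) (X Y : RWQuiver S R) :
    RWQuiver S R :=
  ⟨POG.tensor X.val Y.val, hS _ X.property _ Y.property⟩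

namespace POGHom

theorem ext_maps {G H : POG} {f g : POGHom G H} (hE : ∀ x, f.edgeMap x = g.edgeMap x)
    (hV : ∀ x, f.vMap x = g.vMap x) (hP : ∀ x, f.epMap x = g.epMap x) : f = g := by
  cases f
  cases g
  obtain rfl := funext hE
  obtain rfl := funext hV
  obtain rfl := funext hP
  rfl

end POGHom

section Gluing

variable {P G H : POG} (b : POGHom P G) (b' : POGHom P H)

open Classical in
/-- The edge-points of `G` inside the gluing: the points hit by `b` are replaced by the
corresponding points of `H`, all others are kept. -/
noncomputable def glueEp (q : G.Eps) : {q : G.Eps // ¬ ∃ p, b.epMap p = q} ⊕ H.Eps :=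
  if h : ∃ p, b.epMap p = q then Sum.inr (b'.epMap h.choose) else Sum.inl ⟨q, h⟩

variable {b} in
theorem glueEp_apply (hb : Function.Injective b.epMap) (p : P.Eps) :
    glueEp b b' (b.epMap p) = Sum.inr (b'.epMap p) := by
  have h : ∃ p', b.epMap p' = b.epMap p := ⟨p, rfl⟩
  rw [glueEp, dif_pos h, hb h.choose_spec]

theorem glueEp_of_notMem {q : G.Eps} (h : ¬ ∃ p, b.epMap p = q) :
    glueEp b b' q = Sum.inl ⟨q, h⟩ := by
  rw [glueEp, dif_neg h]

variable {b b'} in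
theorem exists_of_glueEp_eq_inr (hb : Function.Injective b.epMap) {q : G.Eps} {r : H.Eps}
    (h : glueEp b b' q = Sum.inr r) : ∃ p, b.epMap p = q ∧ b'.epMap p = r := by
  by_cases hq : ∃ p, b.epMap p = q
  · obtain ⟨p, rfl⟩ := hq
    rw [glueEp_apply b' hb] at h
    exact ⟨p, rfl, Sum.inr_injective h⟩
  · simp [glueEp_of_notMem b b' hq] at h

variable {b b'} in
theorem glueEp_injective (hb : Function.Injective b.epMap) (hb' : Function.Injective b'.epMap) :
    Function.Injective (glueEp b b') := by
  intro q q' h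
  by_cases hq : ∃ p, b.epMap p = q
  · obtain ⟨p, rfl⟩ := hq
    rw [glueEp_apply b' hb] at h
    obtain ⟨p', rfl, hp'⟩ := exists_of_glueEp_eq_inr hb h.symm
    rw [hb' hp']
  · rw [glueEp_of_notMem b b' hq] at h
    by_cases hq' : ∃ p, b.epMap p = q'
    · obtain ⟨p, rfl⟩ := hq'
      simp [glueEp_apply b' hb] at h
    · simpa [glueEp_of_notMem b b' hq'] using h

/-- The disjoint union of `G` and `H` with the images of the edge-points of `P` identified. -/
noncomputable def glue : POG where
  E := G.E ⊕ H.E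
  V := G.V ⊕ H.V
  Eps := {q : G.Eps // ¬ ∃ p, b.epMap p = q} ⊕ H.Eps
  s := Sum.elim (fun x => Sum.map Sum.inl (glueEp b b') (G.s x))
    (fun x => Sum.map Sum.inr Sum.inr (H.s x))
  t := Sum.elim (fun x => Sum.map Sum.inl (glueEp b b') (G.t x))
    (fun x => Sum.map Sum.inr Sum.inr (H.t x))

/-- The inclusion of the left summand into the gluing. -/
noncomputable def glueInl : POGHom G (glue b b') where
  edgeMap := Sum.inl
  vMap := Sum.inl
  epMap := glueEp b b'
  s_comm := fun _ => rfl
  t_comm := fun _ => rfl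

/-- The inclusion of the right summand into the gluing. -/
noncomputable def glueInr : POGHom H (glue b b') where
  edgeMap := Sum.inr
  vMap := Sum.inr
  epMap := Sum.inr
  s_comm := fun _ => rfl
  t_comm := fun _ => rfl

variable {b b'}

theorem glueInl_comp (hP : P.IsPointGraph) (hb : Function.Injective b.epMap) :
    (glueInl b b').comp b = (glueInr b b').comp b' :=
  POGHom.ext_maps (fun x => (hP.1.false x).elim) (fun x => (hP.2.false x).elim)
    (glueEp_apply b' hb)

/-- Gluing two families of edges along the edge-points keeps an edge-point the end of at most
one edge, provided no identified point is an end of edges from both sides. -/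
theorem glue_end_unique (hb : Function.Injective b.epMap) (hb' : Function.Injective b'.epMap)
    (sG : G.E → G.V ⊕ G.Eps) (sH : H.E → H.V ⊕ H.Eps)
    (hG : ∀ x x' p, sG x = Sum.inr p → sG x' = Sum.inr p → x = x')
    (hH : ∀ x x' p, sH x = Sum.inr p → sH x' = Sum.inr p → x = x')
    (hd : ∀ x y p, sG x = Sum.inr (b.epMap p) → sH y ≠ Sum.inr (b'.epMap p))
    (x x' : G.E ⊕ H.E) (p : {q : G.Eps // ¬ ∃ p, b.epMap p = q} ⊕ H.Eps)
    (h : Sum.elim (fun x => Sum.map Sum.inl (glueEp b b') (sG x))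
      (fun x => Sum.map Sum.inr Sum.inr (sH x)) x = (Sum.inr p : (G.V ⊕ H.V) ⊕ _))
    (h' : Sum.elim (fun x => Sum.map Sum.inl (glueEp b b') (sG x))
      (fun x => Sum.map Sum.inr Sum.inr (sH x)) x' = (Sum.inr p : (G.V ⊕ H.V) ⊕ _)) :
    x = x' := by
  have mixed : ∀ x y, Sum.map (Sum.inl : G.V → G.V ⊕ H.V) (glueEp b b') (sG x) = Sum.inr p →
      Sum.map (Sum.inr : H.V → G.V ⊕ H.V) Sum.inr (sH y) = Sum.inr p → False := by
    intro x y hx hy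
    rcases hxs : sG x with v | q <;> simp [hxs] at hx
    rcases hys : sH y with v | r <;> simp [hys] at hy
    obtain ⟨p, rfl, rfl⟩ := exists_of_glueEp_eq_inr hb (hx.trans hy.symm)
    exact hd x y p hxs hys
  rcases x with x | x <;> rcases x' with x' | x' <;> simp only [Sum.elim_inl, Sum.elim_inr] at h h'
  · rcases hx : sG x with v | q <;> simp [hx] at h
    rcases hx' : sG x' with v | q' <;> simp [hx'] at h'
    obtain rfl := glueEp_injective hb hb' (h.trans h'.symm)
    rw [hG x x' q hx hx']
  · exact (mixed _ _ h h').elim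
  · exact (mixed _ _ h' h).elim
  · rcases hx : sH x with v | q <;> simp [hx] at h
    rcases hx' : sH x' with v | q' <;> simp [hx'] at h'
    obtain rfl := Sum.inr_injective (h.trans h'.symm)
    rw [hH x x' q hx hx']

theorem glue_isOpen (hG : G.IsOpen) (hH : H.IsOpen) (hb : Function.Injective b.epMap)
    (hb' : Function.Injective b'.epMap)
    (hout : ∀ p, G.HasOut (b.epMap p) → ¬ H.HasOut (b'.epMap p))
    (hin : ∀ p, G.HasIn (b.epMap p) → ¬ H.HasIn (b'.epMap p)) : (glue b b').IsOpen :=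
  ⟨glue_end_unique hb hb' G.s H.s hG.1 hH.1 fun x y p hx hy => hout p ⟨x, hx⟩ ⟨y, hy⟩,
    glue_end_unique hb hb' G.t H.t hG.2 hH.2 fun x y p hx hy => hin p ⟨x, hx⟩ ⟨y, hy⟩⟩

/-- At a plugged point, the two sides have opposite directions. -/
theorem IsPluggingAt.opposite {M : POG} {i₁ : POGHom G M} {i₂ : POGHom H M}
    (h : IsPluggingAt b b' i₁ i₂) (p : P.Eps) :
    (G.IsInput (b.epMap p) ∧ H.IsOutput (b'.epMap p)) ∨
      (G.IsOutput (b.epMap p) ∧ H.IsInput (b'.epMap p)) := by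
  obtain ⟨⟨-, -, -, -, -, hcoh, -⟩, hP, hbG, hbH⟩ := h
  have hiso : P.IsIsolated p := ⟨fun ⟨x, _⟩ => hP.1.false x, fun ⟨x, _⟩ => hP.1.false x⟩
  have hG := hbG p
  rcases hcoh.2 p hiso with hi | hi | ⟨hi, ho⟩
  · exact (hG.elim (fun h => hi.2 h.1) fun h => hi.1 h.1).elim
  · exact ((hbH p).elim (fun h => hi.2 h.1) fun h => hi.1 h.1).elim
  · exact hG.imp (fun h => ⟨h, hi.1 h⟩) fun h => ⟨h, ho.1 h⟩

theorem IsPluggingAt.glue_isOpen {M : POG} {i₁ : POGHom G M} {i₂ : POGHom H M}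
    (h : IsPluggingAt b b' i₁ i₂) : (glue b b').IsOpen := by
  refine _root_.glue_isOpen h.1.2.1 h.1.2.2.1 h.1.2.2.2.1.1.2.2 h.1.2.2.2.2.1.1.2.2
    (fun p hG hH => ?_) fun p hG hH => ?_
  · rcases h.opposite p with ⟨-, h'⟩ | ⟨h', -⟩
    · exact h'.2 hH
    · exact h'.2 hG
  · rcases h.opposite p with ⟨h', -⟩ | ⟨-, h'⟩
    · exact h'.2 hG
    · exact h'.2 hH

theorem glueEp_elim {X : Type} {f : G.Eps → X} {g : H.Eps → X}
    (hfg : ∀ p, f (b.epMap p) = g (b'.epMap p)) (hb : Function.Injective b.epMap) (q : G.Eps) :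
    Sum.elim (fun q => f q.1) g (glueEp b b' q) = f q := by
  by_cases hq : ∃ p, b.epMap p = q
  · obtain ⟨p, rfl⟩ := hq
    rw [glueEp_apply b' hb, Sum.elim_inr, hfg]
  · rw [glueEp_of_notMem b b' hq, Sum.elim_inl]

/-- The map out of the gluing induced by a cocone. -/
noncomputable def glueDesc {N : POG} (j₁ : POGHom G N) (j₂ : POGHom H N)
    (hj : j₁.comp b = j₂.comp b') (hb : Function.Injective b.epMap) :
    POGHom (glue b b') N where
  edgeMap := Sum.elim j₁.edgeMap j₂.edgeMap
  vMap := Sum.elim j₁.vMap j₂.vMap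
  epMap := Sum.elim (fun q => j₁.epMap q.1) j₂.epMap
  s_comm := by
    rintro (x | x)
    · simp only [Sum.elim_inl, glue, j₁.s_comm]
      rcases G.s x with v | q
      · rfl
      · simp [glueEp_elim (fun p => congrFun (congrArg POGHom.epMap hj) p) hb]
    · simp only [Sum.elim_inr, glue, j₂.s_comm]
      rcases H.s x with v | q <;> rfl
  t_comm := by
    rintro (x | x)
    · simp only [Sum.elim_inl, glue, j₁.t_comm]
      rcases G.t x with v | q
      · rfl
      · simp [glueEp_elim (fun p => congrFun (congrArg POGHom.epMap hj) p) hb]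
    · simp only [Sum.elim_inr, glue, j₂.t_comm]
      rcases H.t x with v | q <;> rfl

theorem glueDesc_comp_glueInl {N : POG} {j₁ : POGHom G N} {j₂ : POGHom H N}
    (hj : j₁.comp b = j₂.comp b') (hb : Function.Injective b.epMap) :
    (glueDesc j₁ j₂ hj hb).comp (glueInl b b') = j₁ :=
  POGHom.ext_maps (fun _ => rfl) (fun _ => rfl)
    (glueEp_elim (fun p => congrFun (congrArg POGHom.epMap hj) p) hb)

end Gluing

/-- Subtracts always embed: for every open embedding `e : G → M`,
the subtraction `M −ₑ G` (any complement `H` with `G ⊙_p H = M`, `G` embedded by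
`e`) admits an open embedding into `M`, namely the pushout injection. -/
theorem subtraction_embeds
    {G M H P : POG}
    (e : POGHom G M) (he : e.IsEmbedding)
    (b : POGHom P G) (b' : POGHom P H) (i₂ : POGHom H M)
    (hplug : IsPluggingAt b b' e i₂) :
    i₂.IsEmbedding := by
  have hopen := hplug.glue_isOpen
  obtain ⟨⟨-, -, -, hb, -, -, hM, hcomm, huniv⟩, hP, -, -⟩ := hplug
  have hbi := hb.1.2.2
  obtain ⟨u, ⟨hu₁, hu₂⟩, -⟩ :=
    huniv (glue b b') hopen (glueInl b b') (glueInr b b') (glueInl_comp hP hbi)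
  let w := glueDesc e i₂ hcomm hbi
  have hwu : w.comp u = POGHom.id M := by
    refine (huniv M hM e i₂ hcomm).unique ⟨?_, ?_⟩ ⟨rfl, rfl⟩
    · change w.comp (u.comp e) = e
      rw [hu₁]
      exact glueDesc_comp_glueInl hcomm hbi
    · change w.comp (u.comp i₂) = i₂
      rw [hu₂]
      rfl
  have hE : ∀ x, u.edgeMap (i₂.edgeMap x) = Sum.inr x := congrFun (congrArg POGHom.edgeMap hu₂)
  have hV : ∀ x, u.vMap (i₂.vMap x) = Sum.inr x := congrFun (congrArg POGHom.vMap hu₂)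
  have hEps : ∀ x, u.epMap (i₂.epMap x) = Sum.inr x := congrFun (congrArg POGHom.epMap hu₂)
  have hwuE : ∀ m, w.edgeMap (u.edgeMap m) = m := congrFun (congrArg POGHom.edgeMap hwu)
  refine ⟨⟨fun x y h => ?_, fun x y h => ?_, fun x y h => ?_⟩, fun v m hm => ?_⟩
  · exact Sum.inr_injective ((hE x).symm.trans ((congrArg u.edgeMap h).trans (hE y)))
  · exact Sum.inr_injective ((hV x).symm.trans ((congrArg u.vMap h).trans (hV y)))
  · exact Sum.inr_injective ((hEps x).symm.trans ((congrArg u.epMap h).trans (hEps y)))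
  · rcases hx : u.edgeMap m with x | x
    · have hs := u.s_comm m
      have ht := u.t_comm m
      rw [hx] at hs ht
      rcases hm with hm | hm
      · rw [hm, Sum.map_inl, hV] at hs
        rcases hGx : G.s x with a | a <;> simp [glue, hGx] at hs
      · rw [hm, Sum.map_inl, hV] at ht
        rcases hGx : G.t x with a | a <;> simp [glue, hGx] at ht
    · refine ⟨x, ?_⟩
      rw [← hwuE m, hx]
      rfl
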